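/- arXiv:2401.01695 — 2 statements merged into one kernel-verified Lean document; each statement's English description precedes it below -/
import Mathlib

section
/- Let A be an arbitrary index set, X = c₀(A), and let Y be a Banach space and ω an admissible modulus. Then the closure, in the Ċ^{0,ω}(X,Y) seminorm, of the set of maps in C^∞(X,Y) ∩ VC^{0,ω}(X,Y) with bounded support, equals VC^{0,ω}(X,Y). -/
open Filter Set

/-- An admissible modulus of continuity `ω : (0,∞) → (0,∞)`: positive, non-decreasing,
`ω(t) → 0` as `t → 0⁺`, `ω(t) → ∞` as `t → ∞`, `t/ω(t) → 0` as `t → 0⁺`, and doubling. -/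
def Admissible (ω : ℝ → ℝ) : Prop :=
  (∀ t : ℝ, 0 < t → 0 < ω t) ∧
  (∀ s t : ℝ, 0 < s → s ≤ t → ω s ≤ ω t) ∧
  Tendsto ω (nhdsWithin 0 (Ioi 0)) (nhds 0) ∧
  Tendsto ω atTop atTop ∧
  Tendsto (fun t => t / ω t) (nhdsWithin 0 (Ioi 0)) (nhds 0) ∧
  ∃ C : ℝ, 1 < C ∧ ∀ t : ℝ, 0 < t → ω (2 * t) ≤ C * ω t

section Defs

variable {X Y : Type*} [NormedAddCommGroup X] [NormedSpace ℝ X]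
  [NormedAddCommGroup Y] [NormedSpace ℝ Y]

/-- `‖f‖_{Ċ^{0,ω}} ≤ M`. -/
def HolderLE (ω : ℝ → ℝ) (f : X → Y) (M : ℝ) : Prop :=
  ∀ x y : X, x ≠ y → ‖f x - f y‖ ≤ M * ω ‖x - y‖

/-- `f ∈ Ċ^{0,ω}(X,Y)`: the homogeneous Hölder seminorm is finite. -/
def HolderFinite (ω : ℝ → ℝ) (f : X → Y) : Prop :=
  ∃ M : ℝ, HolderLE ω f M

/-- `f ∈ VC^{0,ω}_small(X,Y)`. -/
def VCsmall (ω : ℝ → ℝ) (f : X → Y) : Prop :=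
  HolderFinite ω f ∧
    ∀ ε : ℝ, 0 < ε → ∃ δ : ℝ, 0 < δ ∧ ∀ x y : X, x ≠ y → ‖x - y‖ < δ →
      ‖f x - f y‖ ≤ ε * ω ‖x - y‖

/-- `f ∈ VC^{0,ω}_large(X,Y)`. -/
def VClarge (ω : ℝ → ℝ) (f : X → Y) : Prop :=
  HolderFinite ω f ∧
    ∀ ε : ℝ, 0 < ε → ∃ δ : ℝ, 0 < δ ∧ ∀ x y : X, δ < ‖x - y‖ →
      ‖f x - f y‖ ≤ ε * ω ‖x - y‖

/-- `f ∈ VC^{0,ω}_far(X,Y)`. -/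
def VCfar (ω : ℝ → ℝ) (f : X → Y) : Prop :=
  HolderFinite ω f ∧
    ∀ ε : ℝ, 0 < ε → ∃ δ : ℝ, 0 < δ ∧ ∀ x y : X, x ≠ y → δ < ‖x‖ → δ < ‖y‖ →
      ‖f x - f y‖ ≤ ε * ω ‖x - y‖

/-- `f ∈ VC^{0,ω}(X,Y)`, the intersection of the three vanishing classes. -/
def VCfull (ω : ℝ → ℝ) (f : X → Y) : Prop :=
  VCsmall ω f ∧ VClarge ω f ∧ VCfar ω f

/-- `f` has bounded support: it vanishes outside some bounded set. -/
def BddSupp (f : X → Y) : Prop :=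
  ∃ R : ℝ, ∀ x : X, R < ‖x‖ → f x = 0

end Defs

open MeasureTheory

/-- The truncation of `s` to `[-c, c]`. -/
noncomputable def clip (c s : ℝ) : ℝ := max (-c) (min s c)

theorem continuous_clip (c : ℝ) : Continuous (clip c) := by
  unfold clip; fun_prop

theorem clip_of_abs_le {c s : ℝ} (h : |s| ≤ c) : clip c s = s := by
  obtain ⟨h1, h2⟩ := abs_le.1 h
  rw [clip, min_eq_left h2, max_eq_right h1]

theorem abs_clip_le {c : ℝ} (hc : 0 ≤ c) (s : ℝ) : |clip c s| ≤ c :=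
  abs_le.2 ⟨le_max_left _ _, max_le (by linarith) (min_le_right _ _)⟩

/-- Soft thresholding at level `c`. -/
noncomputable def soft (c s : ℝ) : ℝ := s - clip c s

theorem soft_of_abs_le {c s : ℝ} (h : |s| ≤ c) : soft c s = 0 := by
  rw [soft, clip_of_abs_le h, sub_self]

theorem abs_soft_sub_soft_le (c s t : ℝ) : |soft c s - soft c t| ≤ |s - t| := by
  unfold soft clip
  rcases le_total s c with h1 | h1 <;> rcases le_total t c with h2 | h2 <;>
    simp only [h1, h2, min_eq_left, min_eq_right] <;>
    grind

theorem abs_soft_sub_le {c : ℝ} (hc : 0 ≤ c) (s : ℝ) : |soft c s - s| ≤ c := by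
  rw [soft, sub_sub_cancel_left, abs_neg]
  exact abs_clip_le hc s

section Mollify

/-- The measure on `ℝ` with density a normalized smooth bump. -/
noncomputable def bumpMeasure (φ : ContDiffBump (0 : ℝ)) : Measure ℝ :=
  volume.withDensity fun x => ENNReal.ofReal (φ.normed volume x)

instance (φ : ContDiffBump (0 : ℝ)) : IsProbabilityMeasure (bumpMeasure φ) := by
  constructor
  rw [bumpMeasure, withDensity_apply _ MeasurableSet.univ, Measure.restrict_univ,
    ← ofReal_integral_eq_lintegral_ofReal φ.integrable_normed
      (Eventually.of_forall φ.nonneg_normed), φ.integral_normed, ENNReal.ofReal_one]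

theorem pi_bumpMeasure {ι : Type*} [Fintype ι] (φ : ContDiffBump (0 : ℝ)) :
    Measure.pi (fun _ : ι => bumpMeasure φ) =
      volume.withDensity fun u : ι → ℝ => ENNReal.ofReal (∏ i, φ.normed volume (u i)) := by
  refine Measure.pi_eq fun s hs => ?_
  have hi : ∀ i, Integrable (φ.normed volume) (volume.restrict (s i)) := fun i =>
    φ.integrable_normed.restrict
  rw [withDensity_apply _ (MeasurableSet.univ_pi hs), volume_pi, Measure.restrict_pi_pi,
    ← ofReal_integral_eq_lintegral_ofReal (Integrable.fintype_prod hi)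
      (Eventually.of_forall fun u => Finset.prod_nonneg fun i _ => φ.nonneg_normed _),
    integral_fintype_prod_eq_prod (f := fun _ : ι => φ.normed volume),
    ENNReal.ofReal_prod_of_nonneg
      (fun i _ => integral_nonneg fun x => φ.nonneg_normed x)]
  refine Finset.prod_congr rfl fun i _ => ?_
  rw [bumpMeasure, withDensity_apply _ (hs i), ofReal_integral_eq_lintegral_ofReal (hi i)
    (Eventually.of_forall φ.nonneg_normed)]

theorem contDiff_integral_pi_bumpMeasure {ι : Type*} [Fintype ι] {Y : Type*}
    [NormedAddCommGroup Y] [NormedSpace ℝ Y] [CompleteSpace Y] (φ : ContDiffBump (0 : ℝ))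
    {h : (ι → ℝ) → Y} (hh : Continuous h) :
    ContDiff ℝ (⊤ : ℕ∞) fun v : ι → ℝ =>
      ∫ u, h (fun i => v i - clip φ.rOut (u i)) ∂Measure.pi (fun _ : ι => bumpMeasure φ) := by
  set k : (ι → ℝ) → ℝ := fun u => ∏ i, φ.normed volume (u i) with hk
  have k_zero : ∀ u, k u ≠ 0 → ∀ i, |u i| < φ.rOut := by
    intro u hu i
    have : u i ∈ Function.support (φ.normed volume) := fun h0 =>
      hu (Finset.prod_eq_zero (Finset.mem_univ i) h0)
    rw [φ.support_normed_eq] at this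
    simpa using this
  have k_smooth : ContDiff ℝ (⊤ : ℕ∞) k :=
    contDiff_prod fun i _ => φ.contDiff_normed.comp (contDiff_apply ℝ ℝ i)
  have k_supp : HasCompactSupport k := by
    refine HasCompactSupport.of_support_subset_isCompact
      (isCompact_closedBall (0 : ι → ℝ) φ.rOut) fun u hu => ?_
    rw [mem_closedBall_zero_iff, pi_norm_le_iff_of_nonneg φ.rOut_pos.le]
    exact fun i => (k_zero u hu i).le
  have key := k_supp.contDiff_convolution_left (ContinuousLinearMap.lsmul ℝ ℝ) k_smooth
    (hh.locallyIntegrable (μ := (volume : Measure (ι → ℝ))))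
  convert key using 1
  funext v
  rw [pi_bumpMeasure, integral_withDensity_eq_integral_toReal_smul
    (k_smooth.continuous.measurable.ennreal_ofReal)
    (Eventually.of_forall fun _ => ENNReal.ofReal_lt_top), convolution]
  refine integral_congr_ae (Eventually.of_forall fun u => ?_)
  have hk0 : 0 ≤ k u := Finset.prod_nonneg fun i _ => φ.nonneg_normed _
  simp only [ContinuousLinearMap.lsmul_apply]
  rw [ENNReal.toReal_ofReal hk0]
  by_cases hu : k u = 0
  · rw [hu, zero_smul, zero_smul]
  · congr 2
    funext i
    rw [clip_of_abs_le (k_zero u hu i).le, Pi.sub_apply]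

end Mollify

section ZeroAtInfty

open scoped ZeroAtInfty

variable {A : Type*} [TopologicalSpace A]

theorem abs_apply_le_norm (x : C₀(A, ℝ)) (a : A) : |x a| ≤ ‖x‖ := by
  rw [← ZeroAtInftyContinuousMap.norm_toBCF_eq_norm]
  exact x.toBCF.norm_coe_le_norm a

theorem c0_norm_le {x : C₀(A, ℝ)} {C : ℝ} (hC : 0 ≤ C) (h : ∀ a, |x a| ≤ C) : ‖x‖ ≤ C := by
  rw [← ZeroAtInftyContinuousMap.norm_toBCF_eq_norm]
  exact (BoundedContinuousFunction.norm_le hC).2 h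

/-- Evaluation at finitely many coordinates. -/
noncomputable def coordsCLM (F : Finset A) : C₀(A, ℝ) →L[ℝ] (F → ℝ) :=
  ContinuousLinearMap.pi fun a => LinearMap.mkContinuous
    { toFun := fun x => x a, map_add' := fun _ _ => rfl, map_smul' := fun _ _ => rfl } 1
    fun x => by rw [one_mul]; exact abs_apply_le_norm x a

@[simp] theorem coordsCLM_apply (F : Finset A) (x : C₀(A, ℝ)) (a : F) :
    coordsCLM F x a = x a := rfl

variable [DiscreteTopology A]

theorem finite_setOf_le_abs (x : C₀(A, ℝ)) {c : ℝ} (hc : 0 < c) : {a | c ≤ |x a|}.Finite := by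
  have h := (zero_at_infty x).eventually (Metric.ball_mem_nhds (0 : ℝ) hc)
  rw [cocompact_eq_cofinite, eventually_cofinite] at h
  simpa using h

/-- Shift by the clipped noise `u`, followed by a soft thresholding that kills the noise in all
but finitely many coordinates. -/
noncomputable def softShift {η : ℝ} (hη : 0 < η) (x : C₀(A, ℝ)) (u : A → ℝ) : C₀(A, ℝ) where
  toFun a := soft (2 * η) (x a - clip η (u a))
  continuous_toFun := continuous_of_discreteTopology
  zero_at_infty' := by
    rw [cocompact_eq_cofinite]
    refine tendsto_const_nhds.congr' ?_
    have h := (finite_setOf_le_abs x hη).compl_mem_cofinite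
    filter_upwards [h] with a ha
    have h1 : |x a| < η := by simpa using ha
    have h2 := abs_clip_le hη.le (u a)
    exact (soft_of_abs_le (by linarith [abs_sub (x a) (clip η (u a))])).symm

theorem norm_softShift_sub_softShift_le {η : ℝ} (hη : 0 < η) (x y : C₀(A, ℝ)) (u : A → ℝ) :
    ‖softShift hη x u - softShift hη y u‖ ≤ ‖x - y‖ := by
  refine c0_norm_le (norm_nonneg _) fun a => ?_
  refine (abs_soft_sub_soft_le _ _ _).trans ?_
  rw [sub_sub_sub_cancel_right]
  exact abs_apply_le_norm (x - y) a

theorem norm_softShift_sub_le {η : ℝ} (hη : 0 < η) (x : C₀(A, ℝ)) (u : A → ℝ) :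
    ‖softShift hη x u - x‖ ≤ 3 * η := by
  refine c0_norm_le (by positivity) fun a => ?_
  change |soft (2 * η) (x a - clip η (u a)) - x a| ≤ 3 * η
  have h1 := abs_soft_sub_le (c := 2 * η) (by positivity) (x a - clip η (u a))
  have h2 := abs_clip_le hη.le (u a)
  rw [abs_le] at *
  constructor <;> linarith

/-- Soft thresholding of a finitely supported vector. -/
noncomputable def softExtend (c : ℝ) (F : Finset A) (v : F → ℝ) : C₀(A, ℝ) where
  toFun a := open Classical in if h : a ∈ F then soft c (v ⟨a, h⟩) else 0
  continuous_toFun := continuous_of_discreteTopology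
  zero_at_infty' := by
    rw [cocompact_eq_cofinite]
    refine tendsto_const_nhds.congr' ?_
    filter_upwards [F.finite_toSet.compl_mem_cofinite] with a ha
    have ha' : a ∉ F := by simpa using ha
    simp [ha']

theorem continuous_softExtend (c : ℝ) (F : Finset A) : Continuous (softExtend c F) := by
  refine (LipschitzWith.of_dist_le_mul (K := 1) fun v w => ?_).continuous
  rw [NNReal.coe_one, one_mul, dist_eq_norm, dist_eq_norm]
  refine c0_norm_le (norm_nonneg _) fun a => ?_
  by_cases h : a ∈ F
  · have : (softExtend c F v - softExtend c F w) a = soft c (v ⟨a, h⟩) - soft c (w ⟨a, h⟩) := by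
      simp [softExtend, h]
    rw [this]
    exact (abs_soft_sub_soft_le _ _ _).trans (norm_le_pi_norm (v - w) ⟨a, h⟩)
  · have : (softExtend c F v - softExtend c F w) a = 0 := by simp [softExtend, h]
    rw [this, abs_zero]
    exact norm_nonneg _

theorem softShift_eq_softExtend {η : ℝ} (hη : 0 < η) {x : C₀(A, ℝ)} {F : Finset A}
    (hF : ∀ a ∉ F, |x a| ≤ η) (u : A → ℝ) :
    softShift hη x u = softExtend (2 * η) F fun a => x a - clip η (F.restrict u a) := by
  ext a
  by_cases h : a ∈ F
  · simp [softShift, softExtend, h]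
  · have h2 := abs_clip_le hη.le (u a)
    simp only [softShift, softExtend, ZeroAtInftyContinuousMap.coe_mk, h, dif_neg, not_false_eq_true]
    exact soft_of_abs_le (by linarith [abs_sub (x a) (clip η (u a)), hF a h])

/-- Smoothing of `f` by averaging over independent shifts of all the coordinates. -/
noncomputable def mollify {Y : Type*} [NormedAddCommGroup Y] [NormedSpace ℝ Y]
    (φ : ContDiffBump (0 : ℝ)) (f : C₀(A, ℝ) → Y) (x : C₀(A, ℝ)) : Y :=
  ∫ u, f (softShift φ.rOut_pos x u) ∂Measure.infinitePi fun _ : A => bumpMeasure φ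

section Mollify

variable {Y : Type*} [NormedAddCommGroup Y] (φ : ContDiffBump (0 : ℝ)) {f : C₀(A, ℝ) → Y}

theorem continuous_comp_softExtend (hf : Continuous f) (F : Finset A) (v : F → ℝ) :
    Continuous fun u : F → ℝ =>
      f (softExtend (2 * φ.rOut) F fun a => v a - clip φ.rOut (u a)) := by
  refine hf.comp ((continuous_softExtend _ F).comp (continuous_pi fun a => ?_))
  exact continuous_const.sub ((continuous_clip _).comp (continuous_apply a))

theorem aestronglyMeasurable_comp_softShift (hf : Continuous f) (x : C₀(A, ℝ)) :
    AEStronglyMeasurable (fun u => f (softShift φ.rOut_pos x u))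
      (Measure.infinitePi fun _ : A => bumpMeasure φ) := by
  set F := (finite_setOf_le_abs x φ.rOut_pos).toFinset with hF
  have hF' : ∀ a ∉ F, |x a| ≤ φ.rOut := fun a ha => by
    simp only [hF, Finite.mem_toFinset, mem_ofPred_eq, not_le] at ha
    exact ha.le
  simp only [softShift_eq_softExtend φ.rOut_pos hF']
  exact ((continuous_comp_softExtend φ hf F fun a => x a).stronglyMeasurable.comp_measurable
    (Finset.measurable_restrict F)).aestronglyMeasurable

theorem integrable_comp_softShift (hf : Continuous f) {B : ℝ} (hB : ∀ x, ‖f x‖ ≤ B)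
    (x : C₀(A, ℝ)) : Integrable (fun u => f (softShift φ.rOut_pos x u))
      (Measure.infinitePi fun _ : A => bumpMeasure φ) :=
  .of_bound (aestronglyMeasurable_comp_softShift φ hf x) B (Eventually.of_forall fun _ => hB _)

variable [NormedSpace ℝ Y]

theorem mollify_eq_integral_pi (hf : Continuous f) {F : Finset A} {x : C₀(A, ℝ)}
    (hF : ∀ a ∉ F, |x a| ≤ φ.rOut) :
    mollify φ f x = ∫ u, f (softExtend (2 * φ.rOut) F fun a => coordsCLM F x a -
      clip φ.rOut (u a)) ∂Measure.pi fun _ : F => bumpMeasure φ := by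
  have hm := Measure.infinitePi_map_restrict (μ := fun _ : A => bumpMeasure φ) (I := F)
  rw [mollify, ← hm, integral_map (Finset.measurable_restrict F).aemeasurable
    (continuous_comp_softExtend φ hf F _).stronglyMeasurable.aestronglyMeasurable]
  simp only [softShift_eq_softExtend φ.rOut_pos hF, coordsCLM_apply]

theorem contDiff_mollify [CompleteSpace Y] (hf : Continuous f) :
    ContDiff ℝ (⊤ : ℕ∞) (mollify φ f) := by
  rw [contDiff_iff_contDiffAt]
  intro x₀
  have hη := φ.rOut_pos
  set F := (finite_setOf_le_abs x₀ (half_pos hη)).toFinset with hF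
  have hsm := (contDiff_integral_pi_bumpMeasure φ
    (hf.comp (continuous_softExtend (2 * φ.rOut) F))).comp (coordsCLM F).contDiff
  refine hsm.contDiffAt.congr_of_eventuallyEq ?_
  filter_upwards [Metric.ball_mem_nhds x₀ (half_pos hη)] with x hx
  refine mollify_eq_integral_pi φ hf fun a ha => ?_
  simp only [hF, Finite.mem_toFinset, mem_ofPred_eq, not_le] at ha
  have h1 : |x a - x₀ a| ≤ ‖x - x₀‖ := abs_apply_le_norm (x - x₀) a
  rw [Metric.mem_ball, dist_eq_norm] at hx
  linarith [abs_sub_abs_le_abs_sub (x a) (x₀ a)]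

theorem norm_mollify_le {C : ℝ} {x : C₀(A, ℝ)}
    (h : ∀ u, ‖f (softShift φ.rOut_pos x u)‖ ≤ C) : ‖mollify φ f x‖ ≤ C := by
  simpa [mollify] using norm_integral_le_of_norm_le_const
    (μ := Measure.infinitePi fun _ : A => bumpMeasure φ) (Eventually.of_forall h)

theorem norm_mollify_sub_mollify_le (hf : Continuous f) {B : ℝ} (hB : ∀ x, ‖f x‖ ≤ B) {C : ℝ}
    {x y : C₀(A, ℝ)}
    (h : ∀ u, ‖f (softShift φ.rOut_pos x u) - f (softShift φ.rOut_pos y u)‖ ≤ C) :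
    ‖mollify φ f x - mollify φ f y‖ ≤ C := by
  rw [mollify, mollify, ← integral_sub (integrable_comp_softShift φ hf hB x)
    (integrable_comp_softShift φ hf hB y)]
  simpa using norm_integral_le_of_norm_le_const
    (μ := Measure.infinitePi fun _ : A => bumpMeasure φ) (Eventually.of_forall h)

theorem norm_sub_mollify_le [CompleteSpace Y] (hf : Continuous f) {B : ℝ}
    (hB : ∀ x, ‖f x‖ ≤ B) {C : ℝ}
    {x : C₀(A, ℝ)} (h : ∀ u, ‖f x - f (softShift φ.rOut_pos x u)‖ ≤ C) :
    ‖f x - mollify φ f x‖ ≤ C := by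
  have h1 : f x - mollify φ f x = ∫ u, (f x - f (softShift φ.rOut_pos x u))
      ∂Measure.infinitePi fun _ : A => bumpMeasure φ := by
    rw [integral_sub (integrable_const _) (integrable_comp_softShift φ hf hB x)]
    simp [mollify]
  rw [h1]
  simpa using norm_integral_le_of_norm_le_const
    (μ := Measure.infinitePi fun _ : A => bumpMeasure φ) (Eventually.of_forall h)

end Mollify

end ZeroAtInfty

section Modulus

theorem Admissible.exists_mul_div_le {ω : ℝ → ℝ} (hω : Admissible ω) {K ε : ℝ} (hK : 0 ≤ K)
    (hε : 0 < ε) : ∃ R₀ : ℝ, 0 < R₀ ∧ ∀ R, R₀ ≤ R → ∀ t, 0 < t → t ≤ R → t / R * K ≤ ε * ω t := by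
  obtain ⟨hpos, hmono, -, htop, hlin, -⟩ := hω
  obtain ⟨δ, hδ, hδ'⟩ : ∃ δ > 0, ∀ t, 0 < t → t < δ → t ≤ ω t := by
    have h := hlin.eventually (Iio_mem_nhds one_pos)
    rw [eventually_nhdsWithin_iff, Metric.eventually_nhds_iff] at h
    obtain ⟨δ, hδ, h⟩ := h
    refine ⟨δ, hδ, fun t ht htδ => ?_⟩
    have h1 : t / ω t < 1 := h (by simpa [abs_of_pos ht] using htδ) ht
    exact ((div_lt_one (hpos t ht)).1 h1).le
  obtain ⟨T, hT⟩ := eventually_atTop.1 (htop.eventually_ge_atTop (K / ε))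
  have hωδ := hpos δ hδ
  refine ⟨max 1 (max (K / ε) (K * T / (ε * ω δ))), by positivity, fun R hR t ht htR => ?_⟩
  simp only [max_le_iff] at hR
  obtain ⟨hR1, hR2, hR3⟩ := hR
  have hR0 : 0 < R := by linarith
  rw [div_mul_eq_mul_div, div_le_iff₀ hR0]
  rw [div_le_iff₀ hε] at hR2
  rw [div_le_iff₀ (by positivity)] at hR3
  have hωt := hpos t ht
  rcases lt_or_ge t δ with h1 | h1
  · calc t * K ≤ ω t * (R * ε) := mul_le_mul (hδ' t ht h1) hR2 hK hωt.le
      _ = ε * ω t * R := by ring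
  rcases le_or_gt T t with h2 | h2
  · have h3 := hT t h2
    rw [div_le_iff₀ hε] at h3
    calc t * K ≤ R * (ω t * ε) := mul_le_mul htR h3 hK hR0.le
      _ = ε * ω t * R := by ring
  · calc t * K ≤ T * K := by gcongr
      _ ≤ R * (ε * ω δ) := by linarith
      _ ≤ R * (ε * ω t) := by gcongr; exact hmono _ _ hδ h1
      _ = ε * ω t * R := by ring

theorem Admissible.exists_mul_le {ω : ℝ → ℝ} (hω : Admissible ω) {K ε : ℝ} (hK : 0 ≤ K)
    (hε : 0 < ε) : ∃ δ : ℝ, 0 < δ ∧ ∀ t, 0 < t → t < δ → t * K ≤ ε * ω t := by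
  obtain ⟨hpos, -, -, -, hlin, -⟩ := hω
  have h := hlin.eventually (Iio_mem_nhds (show 0 < ε / (K + 1) by positivity))
  rw [eventually_nhdsWithin_iff, Metric.eventually_nhds_iff] at h
  obtain ⟨δ, hδ, h⟩ := h
  refine ⟨δ, hδ, fun t ht htδ => ?_⟩
  have h1 : t / ω t < ε / (K + 1) := h (by simpa [abs_of_pos ht] using htδ) ht
  rw [div_lt_div_iff₀ (hpos t ht) (by positivity)] at h1
  linarith

variable {X Y : Type*} [NormedAddCommGroup X] [NormedAddCommGroup Y] {ω : ℝ → ℝ} {f g : X → Y}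

theorem VCsmall.continuous (hω : Admissible ω) (hf : VCsmall ω f) : Continuous f := by
  obtain ⟨hpos, -, hzero, -⟩ := hω
  obtain ⟨δ, hδ, h⟩ := hf.2 1 one_pos
  refine Metric.continuous_iff.2 fun x ε hε => ?_
  have h' := hzero.eventually (Iio_mem_nhds hε)
  rw [eventually_nhdsWithin_iff, Metric.eventually_nhds_iff] at h'
  obtain ⟨δ', hδ', h'⟩ := h'
  refine ⟨min δ δ', lt_min hδ hδ', fun y hy => ?_⟩
  rcases eq_or_ne y x with rfl | hne
  · simpa using hε
  rw [dist_eq_norm] at hy ⊢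
  refine (h y x hne (hy.trans_le (min_le_left _ _))).trans_lt ?_
  rw [one_mul]
  exact h' (by simpa using hy.trans_le (min_le_right _ _)) (norm_pos_iff.2 (sub_ne_zero.2 hne))

theorem vcFull_of_bddSupp (hω : Admissible ω) {B : ℝ} (hB : ∀ x, ‖f x‖ ≤ B) (hf : BddSupp f)
    (hs : ∀ ε : ℝ, 0 < ε → ∃ δ : ℝ, 0 < δ ∧ ∀ x y : X, x ≠ y → ‖x - y‖ < δ →
      ‖f x - f y‖ ≤ ε * ω ‖x - y‖) : VCfull ω f := by
  obtain ⟨hpos, hmono, -, htop, -⟩ := hω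
  obtain ⟨R, hR⟩ := hf
  have hB0 : 0 ≤ B := (norm_nonneg _).trans (hB 0)
  have h2B : ∀ x y, ‖f x - f y‖ ≤ 2 * B := fun x y =>
    (norm_sub_le _ _).trans (by linarith [hB x, hB y])
  have hfin : HolderFinite ω f := by
    obtain ⟨δ, hδ, h⟩ := hs 1 one_pos
    have hωδ := hpos δ hδ
    refine ⟨max 1 (2 * B / ω δ), fun x y hxy => ?_⟩
    have hωt := hpos _ (norm_pos_iff.2 (sub_ne_zero.2 hxy))
    rcases lt_or_ge ‖x - y‖ δ with h1 | h1
    · exact (h x y hxy h1).trans (by gcongr; exact le_max_left _ _)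
    · calc ‖f x - f y‖ ≤ 2 * B := h2B x y
        _ = 2 * B / ω δ * ω δ := by field_simp
        _ ≤ max 1 (2 * B / ω δ) * ω ‖x - y‖ :=
          mul_le_mul (le_max_right _ _) (hmono _ _ hδ h1) hωδ.le (by positivity)
  refine ⟨⟨hfin, hs⟩, ⟨hfin, fun ε hε => ?_⟩, ⟨hfin, fun ε hε => ?_⟩⟩
  · obtain ⟨T, hT⟩ := eventually_atTop.1 (htop.eventually_ge_atTop (2 * B / ε))
    refine ⟨max 1 T, by positivity, fun x y hxy => ?_⟩
    have h1 := hT _ ((le_max_right _ _).trans hxy.le)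
    rw [div_le_iff₀ hε] at h1
    linarith [h2B x y]
  · refine ⟨max 1 R, by positivity, fun x y hxy hx hy => ?_⟩
    rw [hR x ((le_max_right _ _).trans_lt hx), hR y ((le_max_right _ _).trans_lt hy), sub_zero,
      norm_zero]
    exact mul_nonneg hε.le (hpos _ (norm_pos_iff.2 (sub_ne_zero.2 hxy))).le

theorem HolderLE.norm_sub_le {M : ℝ} (hfg : HolderLE ω (fun x => f x - g x) M) {x y : X} (hxy : x ≠ y)
    {ε : ℝ} (hg : ‖g x - g y‖ ≤ ε * ω ‖x - y‖) : ‖f x - f y‖ ≤ (M + ε) * ω ‖x - y‖ := by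
  have h := hfg x y hxy
  calc ‖f x - f y‖ = ‖(f x - g x - (f y - g y)) + (g x - g y)‖ := by congr 1; abel
    _ ≤ M * ω ‖x - y‖ + ε * ω ‖x - y‖ := (norm_add_le _ _).trans (add_le_add h hg)
    _ = (M + ε) * ω ‖x - y‖ := by ring

theorem vcFull_of_forall_approx (hf : HolderFinite ω f)
    (h : ∀ ε : ℝ, 0 < ε → ∃ g : X → Y, VCfull ω g ∧ HolderLE ω (fun x => f x - g x) ε) :
    VCfull ω f := by
  refine ⟨⟨hf, fun ε hε => ?_⟩, ⟨hf, fun ε hε => ?_⟩, ⟨hf, fun ε hε => ?_⟩⟩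
  all_goals obtain ⟨g, ⟨hsmall, hlarge, hfar⟩, hfg⟩ := h (ε / 2) (half_pos hε)
  · obtain ⟨δ, hδ, H⟩ := hsmall.2 (ε / 2) (half_pos hε)
    refine ⟨δ, hδ, fun x y hxy hd => ?_⟩
    simpa using hfg.norm_sub_le hxy (H x y hxy hd)
  · obtain ⟨δ, hδ, H⟩ := hlarge.2 (ε / 2) (half_pos hε)
    refine ⟨δ, hδ, fun x y hd => ?_⟩
    have hxy : x ≠ y := by
      rintro rfl
      rw [sub_self, norm_zero] at hd
      exact hd.not_gt hδ
    simpa using hfg.norm_sub_le hxy (H x y hd)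
  · obtain ⟨δ, hδ, H⟩ := hfar.2 (ε / 2) (half_pos hε)
    refine ⟨δ, hδ, fun x y hxy hx hy => ?_⟩
    simpa using hfg.norm_sub_le hxy (H x y hxy hx hy)

end Modulus

section Truncation

theorem norm_sub_le_of_steps {Y : Type*} [NormedAddCommGroup Y] {γ : ℝ → Y} {a t W : ℝ}
    (hW : 0 ≤ W) (ht : 0 < t)
    (h : ∀ s s', a ≤ s → s < s' → s' - s ≤ t → ‖γ s' - γ s‖ ≤ W) (n : ℕ) :
    ∀ s, a ≤ s → s ≤ a + n * t → ‖γ s - γ a‖ ≤ n * W := by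
  induction n with
  | zero =>
    intro s h1 h2
    have : s = a := by push_cast at h2; linarith
    simp [this]
  | succ n ih =>
    intro s h1 h2
    push_cast at h2 ⊢
    rcases le_or_gt s (a + n * t) with h3 | h3
    · linarith [ih s h1 h3]
    · have h4 : a ≤ a + n * t := le_add_of_nonneg_right (by positivity)
      have h5 := h _ s h4 h3 (by linarith)
      have h6 := ih _ h4 le_rfl
      linarith [norm_sub_le_norm_sub_add_norm_sub (γ s) (γ (a + n * t)) (γ a)]

variable {X Y : Type*} [NormedAddCommGroup X]

/-- A Lipschitz cutoff, equal to `1` on the ball of radius `R` and to `0` off the ball of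
radius `2 * R`. -/
noncomputable def cutoff (R : ℝ) (x : X) : ℝ := max 0 (min 1 (2 - ‖x‖ / R))

theorem cutoff_nonneg (R : ℝ) (x : X) : 0 ≤ cutoff R x := le_max_left _ _

theorem cutoff_le_one (R : ℝ) (x : X) : cutoff R x ≤ 1 := max_le zero_le_one (min_le_left _ _)

theorem cutoff_eq_one {R : ℝ} (hR : 0 < R) {x : X} (hx : ‖x‖ ≤ R) : cutoff R x = 1 := by
  have : ‖x‖ / R ≤ 1 := (div_le_one hR).2 hx
  rw [cutoff, min_eq_left (by linarith), max_eq_right zero_le_one]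

theorem cutoff_eq_zero {R : ℝ} (hR : 0 < R) {x : X} (hx : 2 * R < ‖x‖) : cutoff R x = 0 := by
  have : 2 ≤ ‖x‖ / R := (le_div_iff₀ hR).2 hx.le
  exact max_eq_left ((min_le_right _ _).trans (by linarith))

theorem abs_cutoff_sub_le_one (R : ℝ) (x y : X) : |cutoff R x - cutoff R y| ≤ 1 := by
  have := cutoff_nonneg R x
  have := cutoff_nonneg R y
  have := cutoff_le_one R x
  have := cutoff_le_one R y
  exact abs_le.2 ⟨by linarith, by linarith⟩

theorem abs_cutoff_sub_le {R : ℝ} (hR : 0 < R) (x y : X) :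
    |cutoff R x - cutoff R y| ≤ ‖x - y‖ / R := by
  have h1 : |cutoff R x - cutoff R y| ≤ |(2 - ‖x‖ / R) - (2 - ‖y‖ / R)| := by
    unfold cutoff
    refine (abs_max_sub_max_le_max _ _ _ _).trans (max_le (by simp) ?_)
    exact (abs_min_sub_min_le_max _ _ _ _).trans (max_le (by simp) le_rfl)
  refine h1.trans ?_
  rw [sub_sub_sub_cancel_left, ← sub_div, abs_div, abs_of_pos hR, abs_sub_comm]
  gcongr
  exact abs_norm_sub_norm_le x y

variable [NormedAddCommGroup Y] {ω : ℝ → ℝ} {f : X → Y}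

theorem norm_sub_zero_le_of_far [NormedSpace ℝ X] (hω : Admissible ω) {ε r K : ℝ} (hε : 0 ≤ ε)
    (hr : 0 ≤ r)
    (hfar : ∀ x y : X, x ≠ y → r ≤ ‖x‖ → r ≤ ‖y‖ → ‖f x - f y‖ ≤ ε * ω ‖x - y‖)
    (hK : ∀ x : X, ‖x‖ ≤ r → ‖f x - f 0‖ ≤ K) {t : ℝ} (ht : 0 < t) {n : ℕ} {y : X}
    (hy : ‖y‖ ≤ n * t) : ‖f y - f 0‖ ≤ n * (ε * ω t) + K := by
  have hW : 0 ≤ ε * ω t := mul_nonneg hε (hω.1 t ht).le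
  rcases le_or_gt ‖y‖ r with h | h
  · have : 0 ≤ n * (ε * ω t) := by positivity
    linarith [hK y h]
  have hy0 : 0 < ‖y‖ := hr.trans_lt h
  set e : X := ‖y‖⁻¹ • y with he
  have hen : ‖e‖ = 1 := by rw [he, norm_smul, norm_inv, norm_norm, inv_mul_cancel₀ hy0.ne']
  have hs : ∀ s : ℝ, 0 ≤ s → ‖s • e‖ = s := fun s hs => by
    rw [norm_smul, hen, mul_one, Real.norm_of_nonneg hs]
  have hye : ‖y‖ • e = y := by rw [he, smul_smul, mul_inv_cancel₀ hy0.ne', one_smul]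
  have key := norm_sub_le_of_steps (γ := fun s => f (s • e)) (a := r) hW ht
    (fun s s' h1 h2 h3 => by
      have hd : ‖s' • e - s • e‖ = s' - s := by rw [← sub_smul, hs _ (by linarith)]
      have hne : s' • e ≠ s • e := by
        rw [← sub_ne_zero, ← norm_pos_iff, hd]
        linarith
      have := hfar (s' • e) (s • e) hne (by rw [hs _ (by linarith)]; linarith)
        (by rw [hs _ (by linarith)]; exact h1)
      rw [hd] at this
      refine this.trans ?_
      gcongr
      exact hω.2.1 _ _ (by linarith) h3) n ‖y‖ h.le (by linarith)
  simp only [hye] at key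
  have h0 := hK (r • e) (by rw [hs r hr])
  linarith [norm_sub_le_norm_sub_add_norm_sub (f y) (f (r • e)) (f 0)]

variable [NormedSpace ℝ Y]

theorem exists_bddSupp_approx [NormedSpace ℝ X] (hω : Admissible ω) (hf : VCfull ω f) {ε : ℝ}
    (hε : 0 < ε) :
    ∃ g : X → Y, (∃ B, ∀ x, ‖g x‖ ≤ B) ∧ VCfull ω g ∧ BddSupp g ∧
      HolderLE ω (fun x => f x - g x) (5 * ε) := by
  obtain ⟨⟨⟨M', hM'⟩, hsmall⟩, ⟨-, hlarge⟩, ⟨-, hfar⟩⟩ := hf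
  have hω' := hω
  obtain ⟨hpos, hmono, -⟩ := hω'
  obtain ⟨M, hM0, hM⟩ : ∃ M, 0 ≤ M ∧ HolderLE ω f M := by
    refine ⟨max 0 M', le_max_left _ _, fun x y hxy => (hM' x y hxy).trans ?_⟩
    have := hpos _ (norm_pos_iff.2 (sub_ne_zero.2 hxy))
    gcongr
    exact le_max_right _ _
  have hball : ∀ r, 0 < r → ∀ x : X, ‖x‖ ≤ r → ‖f x - f 0‖ ≤ M * ω r := by
    intro r hr x hx
    rcases eq_or_ne x 0 with rfl | h0
    · rw [sub_self, norm_zero]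
      exact mul_nonneg hM0 (hpos r hr).le
    · refine (hM x 0 h0).trans ?_
      rw [sub_zero]
      gcongr
      exact hmono _ _ (norm_pos_iff.2 h0) hx
  obtain ⟨r₀, hr₀, hfar⟩ := hfar ε hε
  obtain ⟨δ₁, hδ₁, hlarge⟩ := hlarge ε hε
  set r := r₀ + 1 with hr
  have hr0 : 0 < r := by linarith
  obtain ⟨R₀, hR₀, hlin⟩ := hω.exists_mul_div_le (mul_nonneg hM0 (hpos r hr0).le) hε
  set R := max R₀ (r + δ₁) with hRdef
  have hR : 0 < R := lt_max_of_lt_left hR₀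
  have hRr : r + δ₁ ≤ R := le_max_right _ _
  have hgrow : ∀ (x y : X), x ≠ y → ‖y‖ ≤ ‖x‖ →
      ‖(cutoff R x - cutoff R y) • (f y - f 0)‖ ≤ 4 * ε * ω ‖x - y‖ := by
    intro x y hxy hle
    have ht : 0 < ‖x - y‖ := norm_pos_iff.2 (sub_ne_zero.2 hxy)
    rcases lt_or_ge (2 * R) ‖y‖ with h | h
    · rw [cutoff_eq_zero hR h, cutoff_eq_zero hR (h.trans_le hle), sub_self, zero_smul, norm_zero]
      have := hpos _ ht
      positivity
    set t := min ‖x - y‖ R with htdef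
    have ht0 : 0 < t := lt_min ht hR
    have hωt := hpos t ht0
    have hcut : |cutoff R x - cutoff R y| ≤ t / R := by
      rw [htdef, ← min_div_div_right hR.le, div_self hR.ne']
      exact le_min (abs_cutoff_sub_le hR x y) (abs_cutoff_sub_le_one R x y)
    set n := ⌈2 * R / t⌉₊ with hn
    have hn1 : ‖y‖ ≤ n * t := h.trans ((div_le_iff₀ ht0).1 (Nat.le_ceil _))
    have hn2 : n * t ≤ 3 * R := by
      have h1 : (n : ℝ) < 2 * R / t + 1 := Nat.ceil_lt_add_one (by positivity)
      have h2 : t ≤ R := min_le_right _ _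
      calc n * t ≤ (2 * R / t + 1) * t := by gcongr
        _ = 2 * R + t := by field_simp
        _ ≤ 3 * R := by linarith
    have hb := norm_sub_zero_le_of_far hω hε.le hr0.le
      (fun x y hxy hx hy => hfar x y hxy (by linarith) (by linarith)) (hball r hr0) ht0 hn1
    rw [norm_smul, Real.norm_eq_abs]
    calc |cutoff R x - cutoff R y| * ‖f y - f 0‖
        ≤ t / R * (n * (ε * ω t) + M * ω r) := by gcongr
      _ = n * t / R * (ε * ω t) + t / R * (M * ω r) := by ring
      _ ≤ 3 * (ε * ω t) + ε * ω t := by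
        refine add_le_add ?_ (hlin R (le_max_left _ _) t ht0 (min_le_right _ _))
        gcongr
        exact (div_le_iff₀ hR).2 hn2
      _ = 4 * ε * ω t := by ring
      _ ≤ 4 * ε * ω ‖x - y‖ := by
        gcongr
        exact hmono _ _ ht0 (min_le_left _ _)
  set g : X → Y := fun x => cutoff R x • (f x - f 0) with hg
  have hgsupp : BddSupp g := ⟨2 * R, fun x hx => by rw [hg]; simp [cutoff_eq_zero hR hx]⟩
  have hgB : ∀ x, ‖g x‖ ≤ M * ω (2 * R) := by
    intro x
    rcases lt_or_ge (2 * R) ‖x‖ with h | h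
    · have := (hpos (2 * R) (by positivity)).le
      simp only [hg, cutoff_eq_zero hR h, zero_smul, norm_zero]
      positivity
    · rw [hg, norm_smul, Real.norm_of_nonneg (cutoff_nonneg R x)]
      exact (mul_le_of_le_one_left (norm_nonneg _) (cutoff_le_one R x)).trans
        (hball _ (by positivity) x h)
  refine ⟨g, ⟨_, hgB⟩, vcFull_of_bddSupp hω hgB hgsupp fun ε' hε' => ?_, hgsupp, ?_⟩
  · have hB0 : 0 ≤ M * ω (2 * R) := mul_nonneg hM0 (hpos _ (by positivity)).le
    obtain ⟨δ, hδ, h1⟩ := hsmall (ε' / 2) (half_pos hε')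
    obtain ⟨δ', hδ', h2⟩ := hω.exists_mul_le (div_nonneg hB0 hR.le) (half_pos hε')
    refine ⟨min δ δ', lt_min hδ hδ', ?_⟩
    have key : ∀ x y : X, ‖y‖ ≤ ‖x‖ → x ≠ y → ‖x - y‖ < min δ δ' →
        ‖g x - g y‖ ≤ ε' * ω ‖x - y‖ := by
      intro x y hle hxy hd
      have ht : 0 < ‖x - y‖ := norm_pos_iff.2 (sub_ne_zero.2 hxy)
      have e1 : ‖cutoff R x • (f x - f y)‖ ≤ ε' / 2 * ω ‖x - y‖ := by
        rw [norm_smul, Real.norm_of_nonneg (cutoff_nonneg R x)]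
        exact (mul_le_of_le_one_left (norm_nonneg _) (cutoff_le_one R x)).trans
          (h1 x y hxy (hd.trans_le (min_le_left _ _)))
      have e2 : ‖(cutoff R x - cutoff R y) • (f y - f 0)‖ ≤ ε' / 2 * ω ‖x - y‖ := by
        rcases lt_or_ge (2 * R) ‖y‖ with h | h
        · rw [cutoff_eq_zero hR h, cutoff_eq_zero hR (h.trans_le hle), sub_self, zero_smul,
            norm_zero]
          have := hpos _ ht
          positivity
        · rw [norm_smul, Real.norm_eq_abs]
          calc _ ≤ ‖x - y‖ / R * (M * ω (2 * R)) :=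
                mul_le_mul (abs_cutoff_sub_le hR x y) (hball _ (by positivity) y h)
                  (norm_nonneg _) (by positivity)
            _ = ‖x - y‖ * (M * ω (2 * R) / R) := by ring
            _ ≤ _ := h2 _ ht (hd.trans_le (min_le_right _ _))
      have e3 : g x - g y = cutoff R x • (f x - f y) +
          (cutoff R x - cutoff R y) • (f y - f 0) := by
        simp only [hg]
        module
      rw [e3]
      exact (norm_add_le _ _).trans (by linarith)
    intro x y hxy hd
    rcases le_total ‖y‖ ‖x‖ with hle | hle
    · exact key x y hle hxy hd
    · rw [norm_sub_rev] at hd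
      rw [norm_sub_rev, norm_sub_rev x]
      exact key y x hle hxy.symm hd
  · have key : ∀ x y : X, ‖y‖ ≤ ‖x‖ → x ≠ y →
        ‖f x - g x - (f y - g y)‖ ≤ 5 * ε * ω ‖x - y‖ := by
      intro x y hle hxy
      have ht : 0 < ‖x - y‖ := norm_pos_iff.2 (sub_ne_zero.2 hxy)
      have e1 : ‖(1 - cutoff R x) • (f x - f y)‖ ≤ ε * ω ‖x - y‖ := by
        have hωt := hpos _ ht
        rcases le_or_gt ‖x‖ R with h | h
        · rw [cutoff_eq_one hR h, sub_self, zero_smul, norm_zero]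
          positivity
        have h0 : ‖f x - f y‖ ≤ ε * ω ‖x - y‖ := by
          rcases le_or_gt ‖y‖ r with hy | hy
          · exact hlarge x y (by linarith [norm_sub_norm_le x y])
          · exact hfar x y hxy (by linarith) (by linarith)
        rw [norm_smul, Real.norm_of_nonneg (by linarith [cutoff_le_one R x])]
        exact (mul_le_of_le_one_left (norm_nonneg _) (by linarith [cutoff_nonneg R x])).trans h0
      have e3 : f x - g x - (f y - g y) = (1 - cutoff R x) • (f x - f y) -
          (cutoff R x - cutoff R y) • (f y - f 0) := by
        simp only [hg]
        module
      rw [e3]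
      exact (norm_sub_le _ _).trans (by linarith [hgrow x y hxy hle])
    intro x y hxy
    rcases le_total ‖y‖ ‖x‖ with hle | hle
    · exact key x y hle hxy
    · rw [norm_sub_rev, norm_sub_rev x]
      exact key y x hle hxy.symm

end Truncation

section Smoothing

open scoped ZeroAtInfty

variable {A : Type*} [TopologicalSpace A] [DiscreteTopology A]
  {Y : Type*} [NormedAddCommGroup Y] [NormedSpace ℝ Y] [CompleteSpace Y] {ω : ℝ → ℝ}

theorem exists_contDiff_approx (hω : Admissible ω) {f : C₀(A, ℝ) → Y} {B : ℝ}
    (hB : ∀ x, ‖f x‖ ≤ B) (hsupp : BddSupp f) (hf : VCsmall ω f) {ε : ℝ} (hε : 0 < ε) :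
    ∃ g : C₀(A, ℝ) → Y, ContDiff ℝ (⊤ : ℕ∞) g ∧ VCfull ω g ∧ BddSupp g ∧
      HolderLE ω (fun x => f x - g x) (2 * ε) := by
  have hcont := hf.continuous hω
  obtain ⟨hpos, hmono, -⟩ := id hω
  obtain ⟨δ, hδ, hfδ⟩ := hf.2 ε hε
  let φ : ContDiffBump (0 : ℝ) := ⟨δ / 8, δ / 4, by positivity, by linarith⟩
  have hη : φ.rOut = δ / 4 := rfl
  have hmod : ∀ ε' δ' : ℝ, 0 < ε' → (∀ x y : C₀(A, ℝ), x ≠ y → ‖x - y‖ < δ' →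
      ‖f x - f y‖ ≤ ε' * ω ‖x - y‖) → ∀ x y : C₀(A, ℝ), x ≠ y → ‖x - y‖ < δ' →
      ‖mollify φ f x - mollify φ f y‖ ≤ ε' * ω ‖x - y‖ := by
    intro ε' δ' hε' h x y hxy hd
    refine norm_mollify_sub_mollify_le φ hcont hB fun u => ?_
    have hle := norm_softShift_sub_softShift_le φ.rOut_pos x y u
    have hωt := hpos _ (norm_pos_iff.2 (sub_ne_zero.2 hxy))
    rcases eq_or_ne (softShift φ.rOut_pos x u) (softShift φ.rOut_pos y u) with he | hne
    · rw [he, sub_self, norm_zero]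
      positivity
    · refine (h _ _ hne (hle.trans_lt hd)).trans ?_
      gcongr
      exact hmono _ _ (norm_pos_iff.2 (sub_ne_zero.2 hne)) hle
  have hclose : ∀ x, ‖f x - mollify φ f x‖ ≤ ε * ω δ := by
    intro x
    refine norm_sub_mollify_le φ hcont hB fun u => ?_
    have hle := norm_softShift_sub_le φ.rOut_pos x u
    rw [norm_sub_rev] at hle
    have hωδ := hpos δ hδ
    rcases eq_or_ne x (softShift φ.rOut_pos x u) with he | hne
    · rw [← he, sub_self, norm_zero]
      positivity
    · refine (hfδ _ _ hne (by linarith)).trans ?_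
      gcongr
      exact hmono _ _ (norm_pos_iff.2 (sub_ne_zero.2 hne)) (by linarith)
  have hgsupp : BddSupp (mollify φ f) := by
    obtain ⟨R, hR⟩ := hsupp
    refine ⟨R + δ, fun x hx => norm_le_zero_iff.1 (norm_mollify_le φ fun u => ?_)⟩
    have hle := norm_softShift_sub_le φ.rOut_pos x u
    rw [norm_sub_rev] at hle
    rw [hR _ (by linarith [norm_sub_norm_le x (softShift φ.rOut_pos x u)]), norm_zero]
  refine ⟨mollify φ f, contDiff_mollify φ hcont,
    vcFull_of_bddSupp hω (fun x => norm_mollify_le φ fun _ => hB _) hgsupp fun ε' hε' => ?_,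
    hgsupp, fun x y hxy => ?_⟩
  · obtain ⟨δ', hδ', h⟩ := hf.2 ε' hε'
    exact ⟨δ', hδ', hmod ε' δ' hε' h⟩
  · rcases lt_or_ge ‖x - y‖ δ with h | h
    · have h1 := hfδ x y hxy h
      have h2 := hmod ε δ hε hfδ x y hxy h
      rw [sub_sub_sub_comm]
      exact (norm_sub_le _ _).trans (by linarith)
    · have h1 : ε * ω δ ≤ ε * ω ‖x - y‖ := by
        gcongr
        exact hmono _ _ hδ h
      exact (norm_sub_le _ _).trans (by linarith [hclose x, hclose y])

end Smoothing

/-- Theorem 1.5 (ii) (Theorem 5.6 (ii)): for `X = c₀(𝒜)` (modelled as the space `C₀(A, ℝ)` of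
functions on a discrete space `A` vanishing at infinity, with the sup norm) and `Y` a Banach
space, the closure of the boundedly supported maps in `C^∞(X,Y) ∩ VC^{0,ω}(X,Y)` in the
`Ċ^{0,ω}` seminorm equals `VC^{0,ω}(X,Y)`. -/
theorem closure_smooth_vc_bs_eq_vc_c0
    {A : Type*} [TopologicalSpace A] [DiscreteTopology A]
    {Y : Type*} [NormedAddCommGroup Y] [NormedSpace ℝ Y] [CompleteSpace Y]
    (ω : ℝ → ℝ) (hω : Admissible ω)
    (f : ZeroAtInftyContinuousMap A ℝ → Y) :
    VCfull ω f ↔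
      (HolderFinite ω f ∧ ∀ ε : ℝ, 0 < ε → ∃ g : ZeroAtInftyContinuousMap A ℝ → Y,
        ContDiff ℝ (⊤ : ℕ∞) g ∧ VCfull ω g ∧ BddSupp g ∧
        HolderLE ω (fun x => f x - g x) ε) := by
  refine ⟨fun hf => ⟨hf.1.1, fun ε hε => ?_⟩, fun ⟨hfin, h⟩ => ?_⟩
  · obtain ⟨g, ⟨B, hB⟩, hg, hsupp, hfg⟩ := exists_bddSupp_approx hω hf (ε := ε / 10) (by positivity)
    obtain ⟨k, hk, hkV, hks, hgk⟩ :=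
      exists_contDiff_approx hω hB hsupp hg.1 (ε := ε / 4) (by positivity)
    refine ⟨k, hk, hkV, hks, fun x y hxy => ?_⟩
    calc ‖f x - k x - (f y - k y)‖
        = ‖(f x - g x - (f y - g y)) + (g x - k x - (g y - k y))‖ := by congr 1; abel
      _ ≤ 5 * (ε / 10) * ω ‖x - y‖ + 2 * (ε / 4) * ω ‖x - y‖ :=
        (norm_add_le _ _).trans (add_le_add (hfg x y hxy) (hgk x y hxy))
      _ = ε * ω ‖x - y‖ := by ring
  · refine vcFull_of_forall_approx hfin fun ε hε => ?_
    obtain ⟨g, -, hg, -, hfg⟩ := h ε hε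
    exact ⟨g, hg, hfg⟩
end

section
/- Let Y be a Banach space and ω an admissible modulus. Then VC^{0,ω}(ℝ^n, Y) equals the closure, in the Ċ^{0,ω}(ℝ^n,Y) seminorm, of the set of C^∞ maps ℝ^n → Y with compact support. -/
open Filter Set

section Basic

variable {X Y : Type*} [NormedAddCommGroup X] [NormedAddCommGroup Y]

lemma HolderFinite.exists_nonneg {ω : ℝ → ℝ} (hpos : ∀ t : ℝ, 0 < t → 0 < ω t) {f : X → Y}
    (hf : HolderFinite ω f) : ∃ M : ℝ, 0 ≤ M ∧ HolderLE ω f M := by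
  obtain ⟨M, hM⟩ := hf
  refine ⟨|M|, abs_nonneg M, fun x y hxy => (hM x y hxy).trans ?_⟩
  have := hpos _ (norm_pos_iff.2 (sub_ne_zero.2 hxy))
  gcongr
  exact le_abs_self M

lemma HolderFinite.continuous {ω : ℝ → ℝ} (hω : Admissible ω) {g : X → Y}
    (hg : HolderFinite ω g) : Continuous g := by
  obtain ⟨M, hM0, hM⟩ := hg.exists_nonneg hω.1
  refine Metric.continuous_iff.2 fun x ε hε => ?_
  have hev := hω.2.2.1.eventually (gt_mem_nhds (show 0 < ε / (M + 1) by positivity))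
  obtain ⟨δ, hδ, hδ'⟩ := mem_nhdsGT_iff_exists_Ioo_subset.1 hev
  refine ⟨δ, hδ, fun y hy => ?_⟩
  rcases eq_or_ne y x with rfl | hyx
  · rwa [dist_self]
  rw [dist_eq_norm] at hy ⊢
  have ht : 0 < ‖y - x‖ := norm_pos_iff.2 (sub_ne_zero.2 hyx)
  have h1 : ω ‖y - x‖ < ε / (M + 1) := hδ' ⟨ht, hy⟩
  rw [lt_div_iff₀ (by positivity)] at h1
  have := hω.1 _ ht
  have h2 := hM y x hyx
  nlinarith

lemma norm_sub_le_of_steps_s7 [NormedSpace ℝ X] (f : X → Y) (u v : X) {N : ℕ} (hN : 0 < N) {b : ℝ}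
    (h : ∀ k < N, ‖f (AffineMap.lineMap u v ((k : ℝ) / N))
      - f (AffineMap.lineMap u v (((k + 1 : ℕ) : ℝ) / N))‖ ≤ b) :
    ‖f u - f v‖ ≤ N * b := by
  have h1 := dist_le_range_sum_of_dist_le (f := fun k : ℕ =>
    f (AffineMap.lineMap u v ((k : ℝ) / N))) (d := fun _ => b) N
    (fun {k} hk => by rw [dist_eq_norm]; exact h k hk)
  have hN' : (N : ℝ) ≠ 0 := by positivity
  simpa [dist_eq_norm, hN'] using h1

/-- Subdividing a segment into steps of length at most `t` bounds an increment of `f` by a multiple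
of `ω t` that is linear in the length of the segment. -/
lemma norm_sub_le_of_segment [NormedSpace ℝ X] {ω : ℝ → ℝ}
    (hpos : ∀ t : ℝ, 0 < t → 0 < ω t) (hmono : ∀ s t : ℝ, 0 < s → s ≤ t → ω s ≤ ω t)
    (f : X → Y) (u v : X) {a t : ℝ} (ha : 0 ≤ a) (ht : 0 < t)
    (h : ∀ p ∈ segment ℝ u v, ∀ q ∈ segment ℝ u v, p ≠ q → min t ‖u - v‖ / 2 ≤ ‖p - q‖ →
      ‖f p - f q‖ ≤ a * ω ‖p - q‖) :
    ‖f u - f v‖ ≤ a * (1 + ‖u - v‖ / t) * ω t := by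
  have hωt := hpos t ht
  rcases eq_or_ne u v with rfl | huv
  · simp only [sub_self, norm_zero]; positivity
  set d := ‖u - v‖ with hd
  have hdpos : 0 < d := norm_pos_iff.2 (sub_ne_zero.2 huv)
  set N := ⌈d / t⌉₊ with hNdef
  have hN : 0 < N := Nat.ceil_pos.2 (by positivity)
  have hN' : (0 : ℝ) < N := by exact_mod_cast hN
  have hNle : (N : ℝ) ≤ 1 + d / t := by
    linarith [Nat.ceil_lt_add_one (show 0 ≤ d / t by positivity)]
  have hst : d / N ≤ t := by
    rw [div_le_iff₀ hN', mul_comm, ← div_le_iff₀ ht]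
    exact Nat.le_ceil _
  have hsmin : min t d / 2 ≤ d / N := by
    rw [le_div_iff₀ hN']
    rcases le_total t d with htd | htd
    · rw [min_eq_left htd]
      have : t * N ≤ t * (1 + d / t) := by gcongr
      rw [mul_add, mul_div_cancel₀ _ ht.ne'] at this
      linarith
    · rw [min_eq_right htd]
      have : d / t ≤ 1 := (div_le_one ht).2 htd
      have : (N : ℝ) ≤ 2 := by linarith
      nlinarith
  have hstep : ‖f u - f v‖ ≤ N * (a * ω t) := by
    refine norm_sub_le_of_steps_s7 f u v hN fun k hk => ?_
    have hk' : ((k + 1 : ℕ) : ℝ) ≤ N := by exact_mod_cast hk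
    have hmem : ∀ j : ℕ, (j : ℝ) ≤ N →
        AffineMap.lineMap u v ((j : ℝ) / N) ∈ segment ℝ u v := fun j hj => by
      rw [segment_eq_image_lineMap]
      exact ⟨_, ⟨by positivity, (div_le_one hN').2 hj⟩, rfl⟩
    have hnorm : ‖(AffineMap.lineMap u v ((k : ℝ) / N) : X)
        - AffineMap.lineMap u v (((k + 1 : ℕ) : ℝ) / N)‖ = d / N := by
      rw [← dist_eq_norm, dist_lineMap_lineMap, Real.dist_eq, dist_eq_norm, ← hd, ← sub_div]
      push_cast
      rw [sub_add_cancel_left, abs_div, abs_neg, abs_one, abs_of_pos hN']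
      ring
    have hspos : 0 < d / N := by positivity
    refine (h _ (hmem k (hk' |>.trans' (by push_cast; linarith))) _ (hmem _ hk') ?_ ?_).trans ?_
    · rw [← sub_ne_zero, ← norm_pos_iff, hnorm]; exact hspos
    · rw [hnorm]; exact hsmin
    · rw [hnorm]
      exact mul_le_mul_of_nonneg_left (hmono _ _ hspos hst) ha
  calc ‖f u - f v‖ ≤ N * (a * ω t) := hstep
    _ ≤ (1 + d / t) * (a * ω t) := by gcongr
    _ = a * (1 + d / t) * ω t := by ring

/-- Increments from the origin to a distant point are small at every scale `t`. -/
lemma VCfull.exists_norm_sub_zero_le [NormedSpace ℝ X] {ω : ℝ → ℝ} (hω : Admissible ω)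
    {f : X → Y} (hf : VCfull ω f) {ε : ℝ} (hε : 0 < ε) :
    ∃ R : ℝ, 0 < R ∧ ∀ y : X, R ≤ ‖y‖ → ∀ t : ℝ, 0 < t →
      ‖f y - f 0‖ ≤ ε * (1 + ‖y‖ / t) * ω t := by
  obtain ⟨hpos, hmono, -⟩ := hω
  obtain ⟨-, ⟨hfin, hlarge⟩, -, hfar⟩ := hf
  obtain ⟨M, hM0, hM⟩ := hfin.exists_nonneg hpos
  have hε2 := half_pos hε
  obtain ⟨δ₁, hδ₁, hlarge⟩ := hlarge (ε / 2) hε2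
  obtain ⟨δ₂, hδ₂, hfar⟩ := hfar (ε / 2) hε2
  set δ := max δ₁ δ₂ with hδdef
  have hδ : 0 < δ := lt_max_of_lt_left hδ₁
  refine ⟨3 * δ + 4 * M * δ / (ε / 2), by positivity, fun y hy t ht => ?_⟩
  have hωt := hpos t ht
  have hy1 : 3 * δ ≤ ‖y‖ := le_trans (le_add_of_nonneg_right (by positivity)) hy
  have hy2 : 4 * M * δ ≤ ε / 2 * ‖y‖ := by
    rw [← div_le_iff₀' hε2]
    exact le_trans (le_add_of_nonneg_left (by positivity)) hy
  have hypos : 0 < ‖y‖ := by linarith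
  rcases le_or_gt t (2 * δ) with htδ | htδ
  · set z : X := (2 * δ / ‖y‖) • y with hz
    have hc : 2 * δ / ‖y‖ ≤ 1 := (div_le_one hypos).2 (by linarith)
    have hnz : ‖z‖ = 2 * δ := by
      rw [hz, norm_smul, Real.norm_of_nonneg (by positivity), div_mul_cancel₀ _ hypos.ne']
    have hyz : ‖y - z‖ ≤ ‖y‖ := by
      have : y - z = (1 - 2 * δ / ‖y‖) • y := by rw [hz, sub_smul, one_smul]
      rw [this, norm_smul, Real.norm_of_nonneg (by linarith)]
      have : 0 ≤ 2 * δ / ‖y‖ := by positivity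
      nlinarith
    have hseg : ∀ p ∈ segment ℝ y z, δ₂ < ‖p‖ := by
      rintro p ⟨a, b, ha, hb, hab, rfl⟩
      have h1 : a • y + b • z = (a + b * (2 * δ / ‖y‖)) • y := by
        rw [hz, smul_smul, add_smul]
      have h2 : (a + b * (2 * δ / ‖y‖)) * ‖y‖ = a * ‖y‖ + b * (2 * δ) := by
        field_simp
      rw [h1, norm_smul, Real.norm_of_nonneg (by positivity), h2]
      have : δ₂ ≤ δ := le_max_right _ _
      nlinarith
    have e1 := norm_sub_le_of_segment hpos hmono f y z hε2.le ht
      fun p hp q hq hpq _ => hfar p q hpq (hseg p hp) (hseg q hq)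
    have e2 := norm_sub_le_of_segment hpos hmono f z 0 hM0 ht
      fun p _ q _ hpq _ => hM p q hpq
    rw [sub_zero, hnz] at e2
    have e3 : ε / 2 * (1 + ‖y - z‖ / t) * ω t ≤ ε / 2 * (1 + ‖y‖ / t) * ω t := by gcongr
    have e4 : M * (1 + 2 * δ / t) * ω t ≤ ε / 2 * (1 + ‖y‖ / t) * ω t := by
      refine mul_le_mul_of_nonneg_right ?_ hωt.le
      have h1 : M * (1 + 2 * δ / t) = M * (t + 2 * δ) / t := by field_simp
      have h2 : ε / 2 * (1 + ‖y‖ / t) = ε / 2 * (t + ‖y‖) / t := by field_simp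
      rw [h1, h2]
      refine div_le_div_of_nonneg_right ?_ ht.le
      nlinarith
    have := norm_sub_le_norm_sub_add_norm_sub (f y) (f z) (f 0)
    linarith
  · have e := norm_sub_le_of_segment hpos hmono f y 0 hε2.le ht fun p _ q _ _ hpq => by
      refine hlarge p q (lt_of_lt_of_le ?_ hpq)
      rw [sub_zero, lt_div_iff₀ two_pos, lt_min_iff]
      have : δ₁ ≤ δ := le_max_left _ _
      constructor <;> linarith
    rw [sub_zero] at e
    refine e.trans ?_
    gcongr
    linarith

/-- The radial cutoff vanishing on the ball of radius `R` and equal to `1` outside the ball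
of radius `2 * R`. -/
noncomputable def radialCutoff (R : ℝ) (x : X) : ℝ := min 1 (max 0 (‖x‖ / R - 1))

lemma radialCutoff_nonneg (R : ℝ) (x : X) : 0 ≤ radialCutoff R x :=
  le_min zero_le_one (le_max_left _ _)

lemma radialCutoff_le_one (R : ℝ) (x : X) : radialCutoff R x ≤ 1 := min_le_left _ _

lemma radialCutoff_eq_zero {R : ℝ} (hR : 0 < R) {x : X} (hx : ‖x‖ ≤ R) :
    radialCutoff R x = 0 := by
  have : ‖x‖ / R ≤ 1 := (div_le_one hR).2 hx
  rw [radialCutoff, max_eq_left (by linarith), min_eq_right zero_le_one]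

lemma radialCutoff_eq_one {R : ℝ} (hR : 0 < R) {x : X} (hx : 2 * R ≤ ‖x‖) :
    radialCutoff R x = 1 := by
  have : 2 ≤ ‖x‖ / R := (le_div_iff₀ hR).2 hx
  exact min_eq_left (le_max_of_le_right (by linarith))

lemma abs_radialCutoff_sub_le_one (R : ℝ) (x y : X) :
    |radialCutoff R x - radialCutoff R y| ≤ 1 := by
  rw [abs_le]
  constructor <;> linarith [radialCutoff_nonneg R x, radialCutoff_nonneg R y,
    radialCutoff_le_one R x, radialCutoff_le_one R y]

lemma abs_radialCutoff_sub_le {R : ℝ} (hR : 0 < R) (x y : X) :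
    |radialCutoff R x - radialCutoff R y| ≤ ‖x - y‖ / R := by
  have h1 := abs_min_sub_min_le_max (1 : ℝ) (max 0 (‖x‖ / R - 1)) 1 (max 0 (‖y‖ / R - 1))
  have h2 := abs_max_sub_max_le_max (0 : ℝ) (‖x‖ / R - 1) 0 (‖y‖ / R - 1)
  have h3 (a : ℝ) : max 0 |a| = |a| := max_eq_right (abs_nonneg a)
  simp only [sub_self, abs_zero, h3] at h1 h2
  refine (h1.trans h2).trans ?_
  rw [sub_sub_sub_cancel_right, ← sub_div, abs_div, abs_of_pos hR]
  gcongr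
  exact abs_norm_sub_norm_le x y

end Basic

section Approximation

variable {X Y : Type*} [NormedAddCommGroup X] [NormedSpace ℝ X]
  [NormedAddCommGroup Y] [NormedSpace ℝ Y]

/-- A limit of smooth compactly supported maps in the Hölder seminorm lies in all three
vanishing classes. -/
lemma vcFull_of_approx {ω : ℝ → ℝ} (hω : Admissible ω) {f : X → Y} (hf : HolderFinite ω f)
    (h : ∀ ε : ℝ, 0 < ε → ∃ g : X → Y, ContDiff ℝ (⊤ : ℕ∞) g ∧ HasCompactSupport g ∧
      HolderLE ω (fun x => f x - g x) ε) : VCfull ω f := by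
  obtain ⟨hpos, -, -, htop, hdiv, -⟩ := hω
  have key : ∀ {ε : ℝ} {g : X → Y}, HolderLE ω (fun x => f x - g x) (ε / 2) → ∀ x y : X, x ≠ y →
      ‖g x - g y‖ ≤ ε / 2 * ω ‖x - y‖ → ‖f x - f y‖ ≤ ε * ω ‖x - y‖ := by
    intro ε g hg x y hxy h1
    have h2 := hg x y hxy
    have h3 : f x - f y = ((f x - g x) - (f y - g y)) + (g x - g y) := by abel
    rw [h3]
    refine (norm_add_le _ _).trans ?_
    dsimp only at h2
    linarith
  refine ⟨⟨hf, fun ε hε => ?_⟩, ⟨hf, fun ε hε => ?_⟩, ⟨hf, fun ε hε => ?_⟩⟩ <;>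
    obtain ⟨g, hgs, hgc, hg⟩ := h (ε / 2) (half_pos hε)
  · obtain ⟨L, hL⟩ := ContDiff.lipschitzWith_of_hasCompactSupport hgc hgs (by simp)
    have hL' : (0 : ℝ) < L + 1 := by positivity
    have hev := hdiv.eventually (gt_mem_nhds (show 0 < ε / 2 / (L + 1) by positivity))
    obtain ⟨δ, hδ, hδ'⟩ := mem_nhdsGT_iff_exists_Ioo_subset.1 hev
    refine ⟨δ, hδ, fun x y hxy hlt => key hg x y hxy ?_⟩
    have ht : 0 < ‖x - y‖ := norm_pos_iff.2 (sub_ne_zero.2 hxy)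
    have h1 : ‖x - y‖ / ω ‖x - y‖ < ε / 2 / (L + 1) := hδ' ⟨ht, hlt⟩
    rw [div_lt_div_iff₀ (hpos _ ht) hL'] at h1
    have h2 := hL.norm_sub_le x y
    nlinarith
  · obtain ⟨B, hB⟩ := hgs.continuous.bounded_above_of_compact_support hgc
    obtain ⟨δ, hδ⟩ := eventually_atTop.1 (htop.eventually_ge_atTop (2 * B / (ε / 2)))
    refine ⟨max δ 1, by positivity, fun x y hxy => ?_⟩
    have ht : 0 < ‖x - y‖ := lt_trans (by positivity) hxy
    refine key hg x y (sub_ne_zero.1 (norm_pos_iff.1 ht)) ?_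
    have h1 := hδ ‖x - y‖ ((le_max_left _ _).trans hxy.le)
    rw [div_le_iff₀ (half_pos hε)] at h1
    have := norm_sub_le (g x) (g y)
    linarith [hB x, hB y]
  · obtain ⟨R, hR⟩ := hgc.isCompact.isBounded.exists_norm_le
    refine ⟨max R 1, by positivity, fun x y hxy hx hy => key hg x y hxy ?_⟩
    have hz : ∀ z : X, max R 1 < ‖z‖ → g z = 0 := fun z hz => by
      by_contra hne
      exact absurd (hR z (subset_tsupport g hne)) (not_le.2 ((le_max_left _ _).trans_lt hz))
    have := hpos _ (norm_pos_iff.2 (sub_ne_zero.2 hxy))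
    rw [hz x hx, hz y hy, sub_zero, norm_zero]
    positivity

lemma VCfull.exists_hasCompactSupport [ProperSpace X] {ω : ℝ → ℝ} (hω : Admissible ω) {f : X → Y}
    (hf : VCfull ω f) {ε : ℝ} (hε : 0 < ε) :
    ∃ g : X → Y, HasCompactSupport g ∧ HolderLE ω (fun x => f x - g x) ε := by
  have hε' : 0 < ε / 6 := by positivity
  obtain ⟨R₁, hR₁, hrad⟩ := hf.exists_norm_sub_zero_le hω hε'
  obtain ⟨hpos, hmono, -⟩ := hω
  obtain ⟨R₂, hR₂, hfar⟩ := hf.2.2.2 (ε / 6) hε'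
  set R := max R₁ R₂ with hRdef
  have hR : 0 < R := lt_max_of_lt_left hR₁
  set χ : X → ℝ := radialCutoff R with hχ
  refine ⟨fun x => (1 - χ x) • (f x - f 0), ?_, ?_⟩
  · refine HasCompactSupport.of_support_subset_isCompact (isCompact_closedBall (0 : X) (2 * R)) ?_
    intro x hx
    rw [mem_closedBall_zero_iff]
    by_contra! hlt
    exact hx (by simp [hχ, radialCutoff_eq_one hR hlt.le])
  have main : ∀ x y : X, x ≠ y → ‖x‖ ≤ ‖y‖ →
      ‖χ y • (f y - f 0) - χ x • (f x - f 0)‖ ≤ ε * ω ‖x - y‖ := by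
    intro x y hxy hle
    set t := ‖x - y‖ with ht
    have htpos : 0 < t := norm_pos_iff.2 (sub_ne_zero.2 hxy)
    have hωt := hpos t htpos
    have hdec : χ y • (f y - f 0) - χ x • (f x - f 0)
        = χ x • (f y - f x) + (χ y - χ x) • (f y - f 0) := by module
    have e1 : ‖χ x • (f y - f x)‖ ≤ ε / 6 * ω t := by
      rw [norm_smul, Real.norm_of_nonneg (radialCutoff_nonneg R x)]
      rcases le_or_gt ‖x‖ R with hx | hx
      · rw [radialCutoff_eq_zero hR hx, zero_mul]; positivity
      · have h1 : R₂ ≤ R := le_max_right _ _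
        have h2 := hfar x y hxy (by linarith) (by linarith)
        rw [norm_sub_rev] at h2
        exact (mul_le_of_le_one_left (norm_nonneg _) (radialCutoff_le_one R x)).trans h2
    have e2 : ‖(χ y - χ x) • (f y - f 0)‖ ≤ 5 * (ε / 6) * ω t := by
      rw [norm_smul, Real.norm_eq_abs]
      rcases le_or_gt ‖y‖ R with hy | hy
      · rw [hχ, radialCutoff_eq_zero hR hy, radialCutoff_eq_zero hR (hle.trans hy)]
        simp only [sub_self, abs_zero, zero_mul]; positivity
      rcases le_or_gt (2 * R) ‖x‖ with hx | hx
      · rw [hχ, radialCutoff_eq_one hR hx, radialCutoff_eq_one hR (hx.trans hle)]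
        simp only [sub_self, abs_zero, zero_mul]; positivity
      have h1 : |χ y - χ x| ≤ 1 := abs_radialCutoff_sub_le_one R y x
      have h2 : |χ y - χ x| ≤ t / R := by
        rw [ht, norm_sub_rev]; exact abs_radialCutoff_sub_le hR y x
      have h3 : |χ y - χ x| * (‖y‖ / t) ≤ 4 := by
        rcases le_or_gt ‖y‖ (4 * R) with hy4 | hy4
        · calc |χ y - χ x| * (‖y‖ / t) ≤ t / R * (4 * R / t) := by gcongr
            _ = 4 := by field_simp
        · have h4 : ‖y‖ - ‖x‖ ≤ t := by
            rw [ht, norm_sub_rev]; exact norm_sub_norm_le y x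
          calc |χ y - χ x| * (‖y‖ / t) ≤ 1 * 4 := by
                refine mul_le_mul h1 ?_ (by positivity) zero_le_one
                rw [div_le_iff₀ htpos]
                linarith
            _ = 4 := one_mul 4
      calc |χ y - χ x| * ‖f y - f 0‖
          ≤ |χ y - χ x| * (ε / 6 * (1 + ‖y‖ / t) * ω t) := by
            gcongr
            exact hrad y ((le_max_left _ _).trans hy.le) t htpos
        _ = (|χ y - χ x| + |χ y - χ x| * (‖y‖ / t)) * (ε / 6 * ω t) := by ring
        _ ≤ 5 * (ε / 6 * ω t) := by
            refine mul_le_mul_of_nonneg_right (by linarith) (by positivity)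
        _ = 5 * (ε / 6) * ω t := by ring
    rw [hdec]
    refine (norm_add_le _ _).trans ?_
    linarith
  intro x y hxy
  dsimp only
  have hd : (f x - (1 - χ x) • (f x - f 0)) - (f y - (1 - χ y) • (f y - f 0))
      = χ x • (f x - f 0) - χ y • (f y - f 0) := by module
  rw [hd]
  rcases le_total ‖x‖ ‖y‖ with hle | hle
  · rw [norm_sub_rev]; exact main x y hxy hle
  · rw [norm_sub_rev x y]; exact main y x hxy.symm hle

end Approximation

section Mollification

open MeasureTheory
open scoped Convolution

variable {X Y : Type*} [NormedAddCommGroup X] [InnerProductSpace ℝ X] [FiniteDimensional ℝ X]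
  [MeasurableSpace X] [BorelSpace X] [NormedAddCommGroup Y] [NormedSpace ℝ Y]

lemma ContDiffBump.norm_normed_convolution_sub_le (φ : ContDiffBump (0 : X)) {g : X → Y}
    (hg : Continuous g) {x y : X} {b : ℝ} (hb : ∀ z : X, ‖g (x - z) - g (y - z)‖ ≤ b) :
    ‖(φ.normed volume ⋆[ContinuousLinearMap.lsmul ℝ ℝ, volume] g) x
      - (φ.normed volume ⋆[ContinuousLinearMap.lsmul ℝ ℝ, volume] g) y‖ ≤ b := by
  have hint : ∀ w : X, Integrable (fun z => φ.normed volume z • g (w - z)) := fun w =>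
    (φ.continuous_normed.smul
      (hg.comp (continuous_const.sub continuous_id))).integrable_of_hasCompactSupport
      φ.hasCompactSupport_normed.smul_right
  simp only [convolution_def, ContinuousLinearMap.lsmul_apply]
  rw [← integral_sub (hint x) (hint y)]
  calc ‖∫ z, (φ.normed volume z • g (x - z) - φ.normed volume z • g (y - z))‖
      ≤ ∫ z, φ.normed volume z * b := by
        refine norm_integral_le_of_norm_le (φ.integrable_normed.mul_const b) (.of_forall fun z => ?_)
        rw [← smul_sub, norm_smul, Real.norm_of_nonneg (φ.nonneg_normed z)]
        exact mul_le_mul_of_nonneg_left (hb z) (φ.nonneg_normed z)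
    _ = b := by rw [integral_mul_const, φ.integral_normed, one_mul]

lemma exists_contDiff_holderLE_sub [CompleteSpace Y] {ω : ℝ → ℝ} (hω : Admissible ω) {g : X → Y}
    (hg : HolderFinite ω g) (hgc : HasCompactSupport g) {ε δ : ℝ} (hε : 0 < ε) (hδ : 0 < δ)
    (hsmall : ∀ x y : X, x ≠ y → ‖x - y‖ < δ → ‖g x - g y‖ ≤ ε * ω ‖x - y‖) :
    ∃ k : X → Y, ContDiff ℝ (⊤ : ℕ∞) k ∧ HasCompactSupport k ∧
      HolderLE ω (fun x => g x - k x) (2 * ε) := by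
  have hcont := hg.continuous hω
  obtain ⟨hpos, hmono, h0, -⟩ := hω
  obtain ⟨M, hM0, hM⟩ := hg.exists_nonneg hpos
  have hωδ := hpos δ hδ
  have hev := h0.eventually (gt_mem_nhds (show 0 < ε * ω δ / (M + 1) by positivity))
  obtain ⟨η, hη, hη'⟩ := mem_nhdsGT_iff_exists_Ioo_subset.1 hev
  have hη : 0 < η := hη
  let φ : ContDiffBump (0 : X) := ⟨η / 2, η, half_pos hη, half_lt_self hη⟩
  have hclose : ∀ x, ‖(φ.normed volume ⋆[ContinuousLinearMap.lsmul ℝ ℝ, volume] g) x - g x‖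
      ≤ ε * ω δ := by
    intro x
    rw [← dist_eq_norm]
    refine φ.dist_normed_convolution_le hcont.aestronglyMeasurable fun y hy => ?_
    rcases eq_or_ne y x with rfl | hyx
    · rw [dist_self]; positivity
    rw [Metric.mem_ball, dist_eq_norm] at hy
    rw [dist_eq_norm]
    have ht : 0 < ‖y - x‖ := norm_pos_iff.2 (sub_ne_zero.2 hyx)
    have h1 : ω ‖y - x‖ < ε * ω δ / (M + 1) := hη' ⟨ht, hy⟩
    rw [lt_div_iff₀ (by positivity)] at h1
    have := hpos _ ht
    have h2 := hM y x hyx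
    nlinarith
  refine ⟨φ.normed volume ⋆[ContinuousLinearMap.lsmul ℝ ℝ, volume] g, ?_, ?_, ?_⟩
  · exact φ.hasCompactSupport_normed.contDiff_convolution_left _ φ.contDiff_normed
      hcont.locallyIntegrable
  · exact φ.hasCompactSupport_normed.convolution _ hgc
  intro x y hxy
  dsimp only
  rcases lt_or_ge ‖x - y‖ δ with hlt | hge
  · have h1 := φ.norm_normed_convolution_sub_le hcont (x := x) (y := y)
      (b := ε * ω ‖x - y‖) fun z => by
        have := hsmall (x - z) (y - z) (by simpa using hxy)
        rw [sub_sub_sub_cancel_right] at this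
        exact this hlt
    rw [sub_sub_sub_comm]
    refine (norm_sub_le _ _).trans ?_
    linarith [hsmall x y hxy hlt]
  · have h1 := hclose x
    have h2 := hclose y
    rw [norm_sub_rev] at h1 h2
    refine (norm_sub_le _ _).trans ?_
    have := mul_le_mul_of_nonneg_left (hmono δ _ hδ hge) hε.le
    linarith

end Mollification

/-- Theorem 1.6: for `Y` a Banach space, `VC^{0,ω}(ℝⁿ, Y)` equals the closure, in the
`Ċ^{0,ω}` seminorm, of the compactly supported `C^∞` maps `ℝⁿ → Y`. -/
theorem vc_eq_closure_smooth_compactly_supported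
    (n : ℕ) {Y : Type*} [NormedAddCommGroup Y] [NormedSpace ℝ Y] [CompleteSpace Y]
    (ω : ℝ → ℝ) (hω : Admissible ω)
    (f : EuclideanSpace ℝ (Fin n) → Y) :
    VCfull ω f ↔
      (HolderFinite ω f ∧ ∀ ε : ℝ, 0 < ε → ∃ g : EuclideanSpace ℝ (Fin n) → Y,
        ContDiff ℝ (⊤ : ℕ∞) g ∧ HasCompactSupport g ∧
        HolderLE ω (fun x => f x - g x) ε) := by
  refine ⟨fun hf => ⟨hf.1.1, fun ε hε => ?_⟩, fun h => vcFull_of_approx hω h.1 h.2⟩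
  have hε5 : 0 < ε / 5 := by positivity
  obtain ⟨g, hgc, hg⟩ := hf.exists_hasCompactSupport hω hε5
  obtain ⟨⟨M, hM⟩, hsmall⟩ := hf.1
  obtain ⟨δ, hδ, hsmall⟩ := hsmall (ε / 5) hε5
  have hsplit : ∀ x y, ‖g x - g y‖ ≤ ‖f x - f y‖ + ‖(f x - g x) - (f y - g y)‖ := fun x y => by
    have : g x - g y = (f x - f y) - ((f x - g x) - (f y - g y)) := by abel
    rw [this]
    exact norm_sub_le _ _
  have hgfin : HolderFinite ω g := ⟨M + ε / 5, fun x y hxy => by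
    have := hM x y hxy
    have := hg x y hxy
    dsimp only at this
    linarith [hsplit x y]⟩
  obtain ⟨k, hks, hkc, hk⟩ := exists_contDiff_holderLE_sub hω hgfin hgc
    (show 0 < 2 * (ε / 5) by positivity) hδ fun x y hxy hlt => by
      have := hsmall x y hxy hlt
      have := hg x y hxy
      dsimp only at this
      linarith [hsplit x y]
  refine ⟨k, hks, hkc, fun x y hxy => ?_⟩
  have h1 := hg x y hxy
  have h2 := hk x y hxy
  dsimp only at h1 h2 ⊢
  have : f x - k x - (f y - k y)
      = ((f x - g x) - (f y - g y)) + ((g x - k x) - (g y - k y)) := by abel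
  rw [this]
  refine (norm_add_le _ _).trans ?_
  linarith
end
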